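/- Let y = v_j be a vertex, x ∈ [v_1, v_n] a point with y < x, and i an index with j < i and v_i < x. Then the function Γ : [w_i^−, w_i^+] → ℝ defined by Γ(w) = Φ^{s(i,w)}(x) − Φ^{s(i,w)}(y) is continuous on [w_i^−, w_i^+]. -/

import Mathlib

open Finset
open scoped Classical

namespace DPN

noncomputable def score (τ c : ℝ) (v w : ℕ → ℝ) (h r j : ℕ) : ℝ :=
  τ * (v h - v j) + (∑ l ∈ Finset.Ioc r j, w l) / c

noncomputable def nextHead (τ c : ℝ) (v w : ℕ → ℝ) (h r : ℕ) : ℕ :=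
  (((Finset.Ioc r h).filter (fun j =>
      ∀ j' ∈ Finset.Ioc r h, score τ c v w h r j' ≤ score τ c v w h r j)).max).getD h

noncomputable def heads (τ c : ℝ) (v w : ℕ → ℝ) (h : ℕ) : ℕ → ℕ
  | 0 => 0
  | m + 1 => nextHead τ c v w h (heads τ c v w h m)

noncomputable def hIdx (n : ℕ) (v : ℕ → ℝ) (x : ℝ) : ℕ :=
  ((Finset.Icc 1 n).filter (fun i => v i < x)).card

noncomputable def phiL (n : ℕ) (τ c : ℝ) (v w : ℕ → ℝ) (x : ℝ) : ℝ :=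
  ∑ m ∈ Finset.range n,
    ((∑ l ∈ Finset.Ioc (heads τ c v w (hIdx n v x) m) (heads τ c v w (hIdx n v x) (m + 1)), w l) *
        (τ * (x - v (heads τ c v w (hIdx n v x) (m + 1)))) +
      (∑ l ∈ Finset.Ioc (heads τ c v w (hIdx n v x) m) (heads τ c v w (hIdx n v x) (m + 1)), w l) ^ 2 /
        (2 * c))

def rv (n : ℕ) (v : ℕ → ℝ) : ℕ → ℝ := fun l => -v (n + 1 - l)

def rw (n : ℕ) (w : ℕ → ℝ) : ℕ → ℝ := fun l => w (n + 1 - l)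

noncomputable def phiR (n : ℕ) (τ c : ℝ) (v w : ℕ → ℝ) (x : ℝ) : ℝ :=
  phiL n τ c (rv n v) (rw n w) (-x)

noncomputable def phi (n : ℕ) (τ c : ℝ) (v w : ℕ → ℝ) (x : ℝ) : ℝ :=
  phiL n τ c v w x + phiR n τ c v w x

/-- The set of scenarios: each vertex weight lies in its interval. -/
def scenarios (n : ℕ) (wm wp : ℕ → ℝ) : Set (ℕ → ℝ) :=
  {s | ∀ i, 1 ≤ i → i ≤ n → wm i ≤ s i ∧ s i ≤ wp i}

/-- The gap `Γ^s(x, y) = Φ^s(x) − Φ^s(y)`. -/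
noncomputable def gap (n : ℕ) (τ c : ℝ) (v s : ℕ → ℝ) (x y : ℝ) : ℝ :=
  phi n τ c v s x - phi n τ c v s y

/-- The regret `R^s(x) = Φ^s(x) − Φ^s(m^s)` (`Φ^s(m^s)` = min of `Φ^s` on `[v_1, v_n]`). -/
noncomputable def regret (n : ℕ) (τ c : ℝ) (v s : ℕ → ℝ) (x : ℝ) : ℝ :=
  phi n τ c v s x - sInf ((fun z => phi n τ c v s z) '' Set.Icc (v 1) (v n))

/-- The maximum regret `R_max(x) = sup_{s ∈ S} R^s(x)`. -/
noncomputable def maxRegret (n : ℕ) (τ c : ℝ) (v wm wp : ℕ → ℝ) (x : ℝ) : ℝ :=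
  sSup {r | ∃ s ∈ scenarios n wm wp, r = regret n τ c v s x}

/-- The left-pseudo-bipartite scenario `s(i, w)`. -/
def pseudoBipL (wm wp : ℕ → ℝ) (i : ℕ) (w : ℝ) : ℕ → ℝ :=
  fun l => if l < i then wp l else if l = i then w else wm l

/-- The right-pseudo-bipartite scenario `s(i, w)`. -/
def pseudoBipR (wm wp : ℕ → ℝ) (i : ℕ) (w : ℝ) : ℕ → ℝ :=
  fun l => if l < i then wm l else if l = i then w else wp l

/-- The head `ρ_m` of the left cluster containing vertex `i`: the smallest cluster head `≥ i`. -/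
noncomputable def clusterHeadOf (τ c : ℝ) (v w : ℕ → ℝ) (h i : ℕ) : ℕ :=
  ((((Finset.range (h + 1)).image (heads τ c v w h)).filter (fun r => i ≤ r)).min).getD h

/-- The head `ρ_{m−1}` preceding the left cluster containing vertex `i`:
the largest cluster head `< i`. -/
noncomputable def prevClusterHeadOf (τ c : ℝ) (v w : ℕ → ℝ) (h i : ℕ) : ℕ :=
  ((((Finset.range (h + 1)).image (heads τ c v w h)).filter (fun r => r < i)).max).getD 0

/-- The weight `σ_m` of the left cluster containing vertex `i`. -/
noncomputable def clusterWeightOf (τ c : ℝ) (v w : ℕ → ℝ) (h i : ℕ) : ℝ :=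
  ∑ l ∈ Finset.Ioc (prevClusterHeadOf τ c v w h i) (clusterHeadOf τ c v w h i), w l

/-- The sequence of right cluster heads for the vertex `y = v_j`
(expressed in the coordinates of the reflected network). -/
noncomputable def rightHeads (n : ℕ) (τ c : ℝ) (v w : ℕ → ℝ) (j : ℕ) : ℕ → ℕ :=
  heads τ c (rv n v) (rw n w) (hIdx n (rv n v) (-(v j)))

/-- The sequence of left cluster heads for the vertex `y = v_j`. -/
noncomputable def leftHeads (n : ℕ) (τ c : ℝ) (v w : ℕ → ℝ) (j : ℕ) : ℕ → ℕ :=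
  heads τ c v w (hIdx n v (v j))

/-- The (original-coordinates) index of the head of the right cluster for `y = v_j`
containing vertex `i`. -/
noncomputable def rightClusterHeadOf (n : ℕ) (τ c : ℝ) (v w : ℕ → ℝ) (j i : ℕ) : ℕ :=
  n + 1 - clusterHeadOf τ c (rv n v) (rw n w) (hIdx n (rv n v) (-(v j))) (n + 1 - i)

/-- The weight of the right cluster for `y = v_j` containing vertex `i`. -/
noncomputable def rightClusterWeightOf (n : ℕ) (τ c : ℝ) (v w : ℕ → ℝ) (j i : ℕ) : ℝ :=
  clusterWeightOf τ c (rv n v) (rw n w) (hIdx n (rv n v) (-(v j))) (n + 1 - i)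

/-- `ω` is a critical weight for `v_i` with respect to the vertex `y = v_j`
(left-pseudo-bipartite case): `ω ∈ {w_i^−, w_i^+}` or the right-cluster partition for `y`
under `s(i, ·)` is not constant on any neighborhood of `ω` in `[w_i^−, w_i^+]`. -/
def criticalWeightL (n : ℕ) (τ c : ℝ) (v wm wp : ℕ → ℝ) (j i : ℕ) (ω : ℝ) : Prop :=
  ω ∈ Set.Icc (wm i) (wp i) ∧
    (ω = wm i ∨ ω = wp i ∨
      ¬ ∃ ε > (0 : ℝ), ∀ w ∈ Set.Icc (wm i) (wp i), |w - ω| < ε →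
        rightHeads n τ c v (pseudoBipL wm wp i w) j =
          rightHeads n τ c v (pseudoBipL wm wp i ω) j)

/-- `ω` is a critical weight for `v_i` with respect to the vertex `y = v_j`
(right-pseudo-bipartite case, using the left-cluster partition for `y`). -/
def criticalWeightR (n : ℕ) (τ c : ℝ) (v wm wp : ℕ → ℝ) (j i : ℕ) (ω : ℝ) : Prop :=
  ω ∈ Set.Icc (wm i) (wp i) ∧
    (ω = wm i ∨ ω = wp i ∨
      ¬ ∃ ε > (0 : ℝ), ∀ w ∈ Set.Icc (wm i) (wp i), |w - ω| < ε →
        leftHeads n τ c v (pseudoBipR wm wp i w) j =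
          leftHeads n τ c v (pseudoBipR wm wp i ω) j)

/-- `Q`: the number of right clusters for `y = v_j` under weights `w` that lie entirely
to the right of the right cluster containing `v_i` (counted via reflected cluster heads). -/
noncomputable def Qnum (n : ℕ) (τ c : ℝ) (v w : ℕ → ℝ) (j i : ℕ) : ℕ :=
  (((Finset.range (n + 1)).image (rightHeads n τ c v w j)).filter
      (fun r => 1 ≤ r ∧
        r < clusterHeadOf τ c (rv n v) (rw n w) (hIdx n (rv n v) (-(v j))) (n + 1 - i))).card

end DPN

open DPN

namespace DPN

theorem score_eq_sub (τ c : ℝ) (v w : ℕ → ℝ) (h : ℕ) {r j : ℕ} (hrj : r ≤ j) :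
    score τ c v w h r j = score τ c v w h 0 j - (∑ l ∈ Finset.Ioc 0 r, w l) / c := by
  have hsum := Finset.sum_Ioc_consecutive w (Nat.zero_le r) hrj
  unfold score
  rw [← hsum]
  ring

theorem nextHead_self (τ c : ℝ) (v w : ℕ → ℝ) (h : ℕ) : nextHead τ c v w h h = h := by
  simp only [nextHead, Finset.Ioc_self, Finset.filter_empty, Finset.max_empty]
  rfl

theorem nextHead_spec (τ c : ℝ) (v w : ℕ → ℝ) {h r : ℕ} (hr : r < h) :
    nextHead τ c v w h r ∈ Finset.Ioc r h ∧
      ∀ j ∈ Finset.Ioc r h,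
        score τ c v w h r j ≤ score τ c v w h r (nextHead τ c v w h r) := by
  obtain ⟨b, hb, hbmax⟩ := Finset.exists_max_image (Finset.Ioc r h) (score τ c v w h r)
    ⟨h, Finset.mem_Ioc.2 ⟨hr, le_rfl⟩⟩
  obtain ⟨a, ha⟩ := Finset.max_of_nonempty
    (s := (Finset.Ioc r h).filter (fun j =>
      ∀ j' ∈ Finset.Ioc r h, score τ c v w h r j' ≤ score τ c v w h r j))
    ⟨b, Finset.mem_filter.2 ⟨hb, hbmax⟩⟩
  have hnext : nextHead τ c v w h r = a := by
    unfold nextHead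
    rw [ha]
    rfl
  rw [hnext]
  exact Finset.mem_filter.1 (Finset.mem_of_max ha)

theorem heads_le (τ c : ℝ) (v w : ℕ → ℝ) (h m : ℕ) : heads τ c v w h m ≤ h := by
  induction m with
  | zero => exact Nat.zero_le h
  | succ m ih =>
    rw [heads]
    rcases ih.lt_or_eq with hlt | heq
    · exact (Finset.mem_Ioc.1 (nextHead_spec τ c v w hlt).1).2
    · rw [heq, nextHead_self]

theorem min_le_heads (τ c : ℝ) (v w : ℕ → ℝ) (h m : ℕ) : min m h ≤ heads τ c v w h m := by
  induction m with
  | zero => simp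
  | succ m ih =>
    rw [heads]
    rcases (heads_le τ c v w h m).lt_or_eq with hlt | heq
    · have := (Finset.mem_Ioc.1 (nextHead_spec τ c v w hlt).1).1
      omega
    · rw [heq, nextHead_self]
      exact min_le_right _ _

theorem heads_eq_of_le (τ c : ℝ) (v w : ℕ → ℝ) {h m : ℕ} (hm : h ≤ m) :
    heads τ c v w h m = h :=
  le_antisymm (heads_le τ c v w h m) ((min_eq_right hm).ge.trans (min_le_heads τ c v w h m))

theorem hIdx_le (n : ℕ) (v : ℕ → ℝ) (x : ℝ) : hIdx n v x ≤ n :=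
  (Finset.card_filter_le _ _).trans (by simp)

/-- The largest score, measured from index `0`, among the indices from `l` to `h`. -/
noncomputable def suffixMax (τ c : ℝ) (v w : ℕ → ℝ) (h l : ℕ) : ℝ :=
  (insert h (Finset.Ico l h)).sup' (Finset.insert_nonempty _ _) (score τ c v w h 0)

theorem suffixMax_eq_of_mem (τ c : ℝ) (v w : ℕ → ℝ) {h r l : ℕ} (hr : r < h)
    (hl : l ∈ Finset.Ioc r (nextHead τ c v w h r)) :
    suffixMax τ c v w h l = score τ c v w h 0 (nextHead τ c v w h r) := by
  obtain ⟨hmem, hmax⟩ := nextHead_spec τ c v w hr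
  rw [Finset.mem_Ioc] at hl hmem
  apply le_antisymm
  · refine Finset.sup'_le _ _ fun j hj => ?_
    have hj' : r < j ∧ j ≤ h := by
      rw [Finset.mem_insert, Finset.mem_Ico] at hj
      omega
    have := hmax j (Finset.mem_Ioc.2 hj')
    rw [score_eq_sub τ c v w h hj'.1.le, score_eq_sub τ c v w h hmem.1.le] at this
    linarith
  · refine Finset.le_sup' (score τ c v w h 0) ?_
    rw [Finset.mem_insert, Finset.mem_Ico]
    omega

/-- The contribution of a cluster, written so that the sum over all clusters telescopes. -/
theorem cluster_term_eq (τ c : ℝ) (hc : c ≠ 0) (v w : ℕ → ℝ) (x : ℝ) {h r : ℕ} (hr : r < h) :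
    (∑ l ∈ Finset.Ioc r (nextHead τ c v w h r), w l) *
        (τ * (x - v (nextHead τ c v w h r))) +
      (∑ l ∈ Finset.Ioc r (nextHead τ c v w h r), w l) ^ 2 / (2 * c) =
    ∑ l ∈ Finset.Ioc r (nextHead τ c v w h r), w l * (suffixMax τ c v w h l + τ * (x - v h)) -
      ((∑ l ∈ Finset.Ioc 0 (nextHead τ c v w h r), w l) ^ 2 -
        (∑ l ∈ Finset.Ioc 0 r, w l) ^ 2) / (2 * c) := by
  have hle := (Finset.mem_Ioc.1 (nextHead_spec τ c v w hr).1).1.le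
  have hsum := Finset.sum_Ioc_consecutive w (Nat.zero_le r) hle
  have hmax : ∑ l ∈ Finset.Ioc r (nextHead τ c v w h r),
        w l * (suffixMax τ c v w h l + τ * (x - v h)) =
      (∑ l ∈ Finset.Ioc r (nextHead τ c v w h r), w l) *
        (score τ c v w h 0 (nextHead τ c v w h r) + τ * (x - v h)) := by
    rw [Finset.sum_mul]
    exact Finset.sum_congr rfl fun l hl => by rw [suffixMax_eq_of_mem τ c v w hr hl]
  rw [hmax, score, ← hsum]
  field_simp
  ring

theorem sum_cluster_eq (τ c : ℝ) (hc : c ≠ 0) (v w : ℕ → ℝ) (x : ℝ) (h k : ℕ) :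
    ∑ m ∈ Finset.range k,
      ((∑ l ∈ Finset.Ioc (heads τ c v w h m) (heads τ c v w h (m + 1)), w l) *
          (τ * (x - v (heads τ c v w h (m + 1)))) +
        (∑ l ∈ Finset.Ioc (heads τ c v w h m) (heads τ c v w h (m + 1)), w l) ^ 2 / (2 * c)) =
    ∑ l ∈ Finset.Ioc 0 (heads τ c v w h k), w l * (suffixMax τ c v w h l + τ * (x - v h)) -
      (∑ l ∈ Finset.Ioc 0 (heads τ c v w h k), w l) ^ 2 / (2 * c) := by
  induction k with
  | zero => simp [heads]
  | succ k ih =>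
    rw [Finset.sum_range_succ, ih, heads]
    rcases (heads_le τ c v w h k).lt_or_eq with hlt | heq
    · have hle := (Finset.mem_Ioc.1 (nextHead_spec τ c v w hlt).1).1.le
      rw [cluster_term_eq τ c hc v w x hlt, ← Finset.sum_Ioc_consecutive
        (fun l => w l * (suffixMax τ c v w h l + τ * (x - v h))) (Nat.zero_le _) hle]
      ring
    · rw [heq, nextHead_self]
      simp

/-- A formula for the left evacuation time that does not mention clusters. -/
theorem phiL_eq (n : ℕ) (τ c : ℝ) (hc : c ≠ 0) (v w : ℕ → ℝ) (x : ℝ) :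
    phiL n τ c v w x =
      ∑ l ∈ Finset.Ioc 0 (hIdx n v x),
        w l * (suffixMax τ c v w (hIdx n v x) l + τ * (x - v (hIdx n v x))) -
      (∑ l ∈ Finset.Ioc 0 (hIdx n v x), w l) ^ 2 / (2 * c) := by
  rw [phiL, sum_cluster_eq τ c hc, heads_eq_of_le τ c v w (hIdx_le n v x)]

theorem continuous_suffixMax (τ c : ℝ) (v : ℕ → ℝ) (h l : ℕ) :
    Continuous fun w => suffixMax τ c v w h l := by
  unfold suffixMax
  refine Continuous.finset_sup'_apply _ fun j _ => ?_
  unfold score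
  fun_prop

theorem continuous_phiL (n : ℕ) (τ c : ℝ) (hc : c ≠ 0) (v : ℕ → ℝ) (x : ℝ) :
    Continuous fun w => phiL n τ c v w x := by
  simp only [phiL_eq n τ c hc]
  have := continuous_suffixMax τ c v (hIdx n v x)
  fun_prop

theorem continuous_phi (n : ℕ) (τ c : ℝ) (hc : c ≠ 0) (v : ℕ → ℝ) (x : ℝ) :
    Continuous fun w => phi n τ c v w x := by
  have hrw : Continuous (DPN.rw n) := by
    unfold DPN.rw
    fun_prop
  exact (continuous_phiL n τ c hc v x).add ((continuous_phiL n τ c hc (rv n v) (-x)).comp hrw)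

theorem continuous_pseudoBipL (wm wp : ℕ → ℝ) (i : ℕ) : Continuous (pseudoBipL wm wp i) := by
  refine continuous_pi fun l => ?_
  unfold pseudoBipL
  split_ifs <;> fun_prop

end DPN

theorem stmt11 (n : ℕ) (τ c : ℝ) (hτ : 0 < τ) (hc : 0 < c) (v : ℕ → ℝ)
    (hv : ∀ i, 1 ≤ i → i < n → v i < v (i + 1))
    (wm wp : ℕ → ℝ) (hwm : ∀ i, 1 ≤ i → i ≤ n → 0 < wm i)
    (hwmp : ∀ i, 1 ≤ i → i ≤ n → wm i ≤ wp i)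
    (j : ℕ) (hj1 : 1 ≤ j) (hjn : j ≤ n)
    (x : ℝ) (hx : x ∈ Set.Icc (v 1) (v n)) (hyx : v j < x)
    (i : ℕ) (hji : j < i) (hin : i ≤ n) (hix : v i < x) :
    ContinuousOn (fun w => gap n τ c v (pseudoBipL wm wp i w) x (v j))
      (Set.Icc (wm i) (wp i)) := by
  exact (((continuous_phi n τ c hc.ne' v x).sub (continuous_phi n τ c hc.ne' v (v j))).comp
    (continuous_pseudoBipL wm wp i)).continuousOn
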